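/- Let k be a field and let m, n be natural numbers. Then the group cohomology H^n(ℤ^m; k) of the free abelian group ℤ^m with coefficients in k (trivial action) is a finite-dimensional k-vector space of dimension equal to the binomial coefficient C(m, n). In particular it vanishes for n > m. -/

import Mathlib

open CategoryTheory

universe u

namespace groupCohomology

open Rep

section Coinduction

variable {k G : Type u} [CommRing k] [Group G] (S : Subgroup G)

lemma shortExact_cokernel_of_mono {A B : Rep.{u} k G} (f : A ⟶ B) [Mono f] :
    (ShortComplex.mk f (Limits.cokernel.π f) (Limits.cokernel.condition f)).ShortExact where
  exact := ShortComplex.exact_cokernel f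

/-- The embedding of a representation into the representation coinduced from its restriction. -/
noncomputable def toCoindRes (A : Rep.{u} k G) : A ⟶ coind S.subtype (res S.subtype A) :=
  resCoindToHom S.subtype A (res S.subtype A) (𝟙 _)

instance (A : Rep.{u} k G) : Mono (toCoindRes S A) := by
  rw [Rep.mono_iff_injective]
  intro x y h
  have := congrFun (congrArg Subtype.val h) 1
  simpa [toCoindRes] using this

lemma isZero_coind_bot (A : Rep.{u} k (⊥ : Subgroup G)) (n : ℕ) :
    Limits.IsZero (groupCohomology (coind (⊥ : Subgroup G).subtype A) (n + 1)) :=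
  (isZero_groupCohomology_succ_of_subsingleton A n).of_iso (coindIso A (n + 1))

end Coinduction

section Comm

variable {k G : Type u} [CommRing k] [CommGroup G]

/-- Group elements of a commutative group act trivially on cohomology. -/
theorem map_applyAsHom (A : Rep.{u} k G) (g : G) (n : ℕ) :
    map (MonoidHom.id G) (A.applyAsHom g) n = 𝟙 _ := by
  induction n generalizing A with
  | zero =>
    rw [← cancel_mono (H0Iso A).hom, map_id_comp_H0Iso_hom]
    ext x
    exact Subtype.ext (((H0Iso A).hom x).2 g)
  | succ n ih =>
    have hX := shortExact_cokernel_of_mono (toCoindRes (⊥ : Subgroup G) A)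
    let X := ShortComplex.mk _ _ (Limits.cokernel.condition (toCoindRes (⊥ : Subgroup G) A))
    let F : X ⟶ X := ⟨X.X₁.applyAsHom g, X.X₂.applyAsHom g, X.X₃.applyAsHom g,
      applyAsHom_comm _ _, applyAsHom_comm _ _⟩
    have : Epi (δ hX n (n + 1) rfl) := epi_δ_of_isZero hX n (isZero_coind_bot _ n)
    have h := δ_naturality hX hX F n (n + 1) rfl
    rw [← cancel_epi (δ hX n (n + 1) rfl)]
    refine h.trans ?_
    have := ih X.X₃
    dsimp only [F]
    rw [this]
    exact (Category.id_comp _).trans (Category.comp_id _).symm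

instance (n : ℕ) : (functor k G n).Additive :=
  inferInstanceAs (cochainsFunctor k G ⋙ HomologicalComplex.homologyFunctor _ _ n).Additive

lemma functor_map_applyAsHom_sub_id (A : Rep.{u} k G) (g : G) (n : ℕ) :
    (functor k G n).map (A.applyAsHom g - 𝟙 A) = 0 := by
  rw [Functor.map_sub, sub_eq_zero, CategoryTheory.Functor.map_id]
  exact map_applyAsHom A g n

end Comm

lemma exists_antidifference {M : Type*} [AddCommGroup M] (f : ℤ → M) :
    ∃ F : ℤ → M, ∀ n, F (n + 1) - F n = f n := by
  refine ⟨fun n ↦ ∑ i ∈ Finset.range n.toNat, f i -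
    ∑ i ∈ Finset.range (-n).toNat, f (-(i + 1)), fun n ↦ ?_⟩
  obtain ⟨n, rfl | rfl⟩ := n.eq_nat_or_neg
  · have h1 : ((n : ℤ) + 1).toNat = n + 1 := by omega
    have h2 : (-((n : ℤ) + 1)).toNat = 0 := by omega
    have h3 : (-(n : ℤ)).toNat = 0 := by omega
    simp only [h1, h2, h3, Finset.sum_range_succ]
    simp
  · cases n with
    | zero => simp
    | succ n =>
      have h1 : (-((n + 1 : ℕ) : ℤ) + 1).toNat = 0 := by omega
      have h2 : (-(-((n + 1 : ℕ) : ℤ) + 1)).toNat = n := by omega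
      have h3 : (-((n + 1 : ℕ) : ℤ)).toNat = 0 := by omega
      have h4 : (- -((n + 1 : ℕ) : ℤ)).toNat = n + 1 := by omega
      simp only [h1, h2, h3, h4, Finset.sum_range_succ]
      simp

section Extension

variable {k G : Type u} [CommRing k] [CommGroup G] (p : G →* Multiplicative ℤ)

/-- The inclusion of the constant functions into the coinduced trivial representation. -/
noncomputable def constCoind (S : Subgroup G) :
    trivial k G k ⟶ coind S.subtype (trivial k S k) :=
  resCoindToHom S.subtype (trivial k G k) (trivial k S k) (𝟙 _)

variable (k) in
/-- The short complex `k ⟶ Coind k ⟶ Coind k` whose second map is `t - 1`. -/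
noncomputable def coindKerComplex (t : G) : ShortComplex (Rep k G) :=
  ShortComplex.mk (constCoind p.ker)
    ((coind p.ker.subtype (trivial k p.ker k)).applyAsHom t - 𝟙 _) (by
      refine Rep.hom_ext (Representation.IntertwiningMap.ext (LinearMap.ext fun x ↦ ?_))
      refine Subtype.ext (funext fun g ↦ ?_)
      exact sub_self x)

lemma coind_ker_apply_eq (f : coind p.ker.subtype (trivial k p.ker k)) {g h : G}
    (hgh : p g = p h) : f.1 g = f.1 h := by
  have := f.2 ⟨g * h⁻¹, by simp [MonoidHom.mem_ker, hgh]⟩ h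
  simpa using this

lemma coindKerComplex_g_apply (t : G) (f : coind p.ker.subtype (trivial k p.ker k)) (g : G) :
    ((coindKerComplex k p t).g.hom f).1 g = f.1 (g * t) - f.1 g := rfl

lemma coindKerComplex_shortExact (t : G) (ht : p t = Multiplicative.ofAdd 1) :
    (coindKerComplex k p t).ShortExact where
  exact := by
    rw [← ShortComplex.exact_map_iff_of_faithful _ (forget₂ (Rep k G) (ModuleCat k)),
      ShortComplex.moduleCat_exact_iff]
    intro (f : coind p.ker.subtype (trivial k p.ker k)) hf
    have hf' (g : G) : f.1 (g * t) = f.1 g :=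
      sub_eq_zero.mp (congrFun (congrArg Subtype.val hf) g)
    refine ⟨f.1 1, Subtype.ext (funext fun g ↦ ?_)⟩
    change f.1 1 = f.1 g
    have hz (n : ℤ) : f.1 (t ^ n) = f.1 1 := by
      induction n using Int.induction_on with
      | zero => simp
      | succ n ih => rw [zpow_add_one, hf', ih]
      | pred n ih => rw [← ih, ← hf', ← zpow_add_one, sub_add_cancel]
    rw [← hz (p g).toAdd]
    refine coind_ker_apply_eq p f ?_
    rw [map_zpow, ht, ← ofAdd_zsmul]
    simp
  mono_f := by
    rw [Rep.mono_iff_injective]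
    intro x y h
    exact congrFun (congrArg Subtype.val h) 1
  epi_g := by
    rw [Rep.epi_iff_surjective]
    intro (f : coind p.ker.subtype (trivial k p.ker k))
    obtain ⟨F, hF⟩ := exists_antidifference fun n : ℤ ↦ f.1 (t ^ n)
    refine ⟨⟨fun g ↦ F (p g).toAdd, fun s g ↦ ?_⟩, Subtype.ext (funext fun g ↦ ?_)⟩
    · have : p s = 1 := s.2
      simp [this]
    · rw [coindKerComplex_g_apply]
      change F (p (g * t)).toAdd - F (p g).toAdd = f.1 g
      rw [map_mul, ht, toAdd_mul, toAdd_ofAdd, hF]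
      refine coind_ker_apply_eq p f ?_
      rw [map_zpow, ht, ← ofAdd_zsmul]
      simp

lemma map_coindKerComplex_g (t : G) (n : ℕ) :
    (functor k G n).map (coindKerComplex k p t).g = 0 :=
  functor_map_applyAsHom_sub_id _ t n

end Extension

section Field

variable {k G : Type u} [Field k] [CommGroup G]

lemma rank_trivial_succ (p : G →* Multiplicative ℤ) (t : G)
    (ht : p t = Multiplicative.ofAdd 1) (n : ℕ) :
    Module.rank k (groupCohomology (trivial k G k) (n + 1)) =
      Module.rank k (groupCohomology (trivial k p.ker k) n) +
        Module.rank k (groupCohomology (trivial k p.ker k) (n + 1)) := by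
  have hX := coindKerComplex_shortExact (k := k) p t ht
  have : Mono (mapShortComplex₁ hX (i := n) rfl).f :=
    (mapShortComplex₃_exact hX (i := n) rfl).mono_g (map_coindKerComplex_g p t n)
  have : Epi (mapShortComplex₁ hX (i := n) rfl).g :=
    (mapShortComplex₂_exact hX (n + 1)).epi_f
      (map_coindKerComplex_g p t (n + 1))
  have hS : (mapShortComplex₁ hX (i := n) rfl).ShortExact := ⟨mapShortComplex₁_exact hX (i := n) rfl⟩
  have e (i : ℕ) := (coindIso (S := p.ker) (trivial k p.ker k) i).toLinearEquiv.rank_eq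
  rw [← e, ← e]
  exact ModuleCat.free_shortExact_rank_add hS

lemma rank_trivial_zero {H : Type u} [Group H] :
    Module.rank k (groupCohomology (trivial k H k) 0) = 1 := by
  rw [(H0IsoOfIsTrivial (trivial k H k)).toLinearEquiv.rank_eq]
  exact Module.rank_self k

lemma rank_trivial_congr {G H : Type u} [Group G] [Group H] (e : G ≃* H) (n : ℕ) :
    Module.rank k (groupCohomology (trivial k G k) n) =
      Module.rank k (groupCohomology (trivial k H k) n) :=
  (mapIso (A := trivial k H k) (B := trivial k G k) e
    (LinearEquiv.refl k k) (fun _ ↦ rfl) n).toLinearEquiv.rank_eq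

end Field

/-- The kernel of the zeroth coordinate on `ℤ ^ (m + 1)` is `ℤ ^ m`. -/
def kerEvalZeroEquiv (m : ℕ) :
    (AddMonoidHom.toMultiplicative (Pi.evalAddMonoidHom (fun _ : Fin (m + 1) ↦ ℤ) 0)).ker ≃*
      Multiplicative (Fin m → ℤ) where
  toFun x := .ofAdd (Fin.tail x.1.toAdd)
  invFun y := ⟨.ofAdd (Fin.cons 0 y.toAdd), rfl⟩
  left_inv x := Subtype.ext (by
    have h : x.1.toAdd 0 = 0 := x.2
    have := Fin.cons_self_tail x.1.toAdd
    rw [h] at this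
    exact this)
  right_inv y := rfl
  map_mul' _ _ := rfl

theorem rank_trivial_int_pow (k : Type) [Field k] (m n : ℕ) :
    Module.rank k (groupCohomology (trivial k (Multiplicative (Fin m → ℤ)) k) n) =
      m.choose n := by
  induction m generalizing n with
  | zero =>
    cases n with
    | zero => simpa using rank_trivial_zero
    | succ n =>
      have := ModuleCat.subsingleton_of_isZero (isZero_groupCohomology_succ_of_subsingleton
        (trivial k (Multiplicative (Fin 0 → ℤ)) k) n)
      simp
  | succ m ih =>
    cases n with
    | zero => simpa using rank_trivial_zero
    | succ n =>
      rw [rank_trivial_succ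
        (AddMonoidHom.toMultiplicative (Pi.evalAddMonoidHom (fun _ : Fin (m + 1) ↦ ℤ) 0))
        (.ofAdd fun _ ↦ 1) rfl n, rank_trivial_congr (kerEvalZeroEquiv m),
        rank_trivial_congr (kerEvalZeroEquiv m), ih, ih, Nat.choose_succ_succ, Nat.cast_add]

end groupCohomology

/-- For any field `k` and naturals `m, n`, the group cohomology
`Hⁿ(ℤ^m; k)` with trivial coefficients is a finite-dimensional `k`-vector space of
dimension `C(m, n)` (in particular it vanishes for `n > m`). -/
theorem stmt5 (k : Type) [Field k] (m n : ℕ) :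
    FiniteDimensional k (groupCohomology (Rep.trivial k (Multiplicative (Fin m → ℤ)) k) n) ∧
    Module.finrank k (groupCohomology (Rep.trivial k (Multiplicative (Fin m → ℤ)) k) n) =
      m.choose n := by
  have h := groupCohomology.rank_trivial_int_pow k m n
  exact ⟨Module.rank_lt_aleph0_iff.mp (h ▸ Cardinal.natCast_lt_aleph0),
    Module.finrank_eq_of_rank_eq h⟩
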